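/- (Lemma 7, second part.) For all n ≥ 2, the matrix L_{2^n} := B_{2^n}† M_{2^n} B_{2^n} is diagonal and its i-th diagonal entry (1-indexed, i = 1, …, 2^n) equals 2τ_i − 1, where (τ_i) is the Thue–Morse sequence. -/

import Mathlib

open Matrix Complex BigOperators

noncomputable section

/-- Cast a square complex matrix along an equality of sizes. -/
def matCast {a b : ℕ} (h : a = b) (A : Matrix (Fin a) (Fin a) ℂ) :
    Matrix (Fin b) (Fin b) ℂ :=
  Matrix.reindex (finCongr h) (finCongr h) A

/-- Kronecker product of square complex matrices, with indices flattened. -/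
def kron {a b : ℕ} (A : Matrix (Fin a) (Fin a) ℂ) (B : Matrix (Fin b) (Fin b) ℂ) :
    Matrix (Fin (a * b)) (Fin (a * b)) ℂ :=
  Matrix.reindex finProdFinEquiv finProdFinEquiv (Matrix.kroneckerMap (· * ·) A B)

/-- Kronecker product of (flattened) vectors. -/
def vkron {a b : ℕ} (u : Fin a → ℂ) (v : Fin b → ℂ) : Fin (a * b) → ℂ :=
  fun i => u (finProdFinEquiv.symm i).1 * v (finProdFinEquiv.symm i).2

/-- Cast a complex vector along an equality of sizes. -/
def vecCast {a b : ℕ} (h : a = b) (v : Fin a → ℂ) : Fin b → ℂ :=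
  fun i => v ((finCongr h).symm i)

def σx : Matrix (Fin 2) (Fin 2) ℂ := !![0, 1; 1, 0]
def σy : Matrix (Fin 2) (Fin 2) ℂ := !![0, -Complex.I; Complex.I, 0]
def σz : Matrix (Fin 2) (Fin 2) ℂ := !![1, 0; 0, -1]
def projL : Matrix (Fin 2) (Fin 2) ℂ := !![1, 0; 0, 0]
def projR : Matrix (Fin 2) (Fin 2) ℂ := !![0, 0; 0, 1]
def H2 : Matrix (Fin 2) (Fin 2) ℂ := (1 / (Real.sqrt 2 : ℂ)) • !![1, 1; 1, -1]

/-- `k`-fold Kronecker power of a 2×2 matrix. -/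
def kpow (A : Matrix (Fin 2) (Fin 2) ℂ) : (k : ℕ) → Matrix (Fin (2 ^ k)) (Fin (2 ^ k)) ℂ
  | 0 => 1
  | k + 1 => matCast (by rw [pow_succ, Nat.mul_comm]) (kron A (kpow A k))

/-- `M_{2^n} := σ_y ⊗ I_{2^{n-2}} ⊗ σ_y` (only meaningful for `n ≥ 2`). -/
def Mmat : (n : ℕ) → Matrix (Fin (2 ^ n)) (Fin (2 ^ n)) ℂ
  | 0 => 1
  | 1 => 1
  | m + 2 =>
      matCast (by ring)
        (kron σy (kron (1 : Matrix (Fin (2 ^ m)) (Fin (2 ^ m)) ℂ) σy))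

/-- `F(ψ) = ⟨ψ| M_{2^n} K |ψ⟩ = Σ_{i,j} conj(ψ_i) (M_{2^n})_{ij} conj(ψ_j)`. -/
def Fval (n : ℕ) (ψ : Fin (2 ^ n) → ℂ) : ℂ :=
  ∑ i, ∑ j, (starRingEnd ℂ) (ψ i) * Mmat n i j * (starRingEnd ℂ) (ψ j)

/-- generalized CNOT gate: `L ⊗ I_{2^{n-1}} + R ⊗ σ_x^{⊗(n-1)}`. -/
def CNOT : (n : ℕ) → Matrix (Fin (2 ^ n)) (Fin (2 ^ n)) ℂ
  | 0 => 1
  | m + 1 =>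
      matCast (by rw [pow_succ, Nat.mul_comm])
        (kron projL (1 : Matrix (Fin (2 ^ m)) (Fin (2 ^ m)) ℂ)) +
      matCast (by rw [pow_succ, Nat.mul_comm]) (kron projR (kpow σx m))

/-- Bell matrix: `B_{2^n} := CNOT_{2^n} (H_{2^{n-1}} ⊗ I₂)`. -/
def Bmat : (n : ℕ) → Matrix (Fin (2 ^ n)) (Fin (2 ^ n)) ℂ
  | 0 => 1
  | m + 1 =>
      CNOT (m + 1) *
        matCast (by rw [pow_succ]) (kron (kpow H2 m) (1 : Matrix (Fin 2) (Fin 2) ℂ))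

/-- `L_{2^n} := B_{2^n}† M_{2^n} B_{2^n}`. -/
def Lmat (n : ℕ) : Matrix (Fin (2 ^ n)) (Fin (2 ^ n)) ℂ :=
  (Bmat n)ᴴ * Mmat n * Bmat n

/-- The GHZ state `(1/√2)(|0…0⟩ + |1…1⟩)` as a vector in `ℂ^{2^n}`. -/
def GHZ (n : ℕ) : Fin (2 ^ n) → ℂ :=
  fun i => if (i : ℕ) = 0 ∨ (i : ℕ) = 2 ^ n - 1 then (1 / (Real.sqrt 2 : ℂ)) else 0

/-- A state `ψ : Fin (2^n) → ℂ`, viewed as a function `(Fin n → Fin 2) → ℂ`. -/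
def toQubits {n : ℕ} (ψ : Fin (2 ^ n) → ℂ) : (Fin n → Fin 2) → ℂ :=
  fun f => ψ (finFunctionFinEquiv f)

/-- Reduced density matrix of qubit `j` of the state `ψ`. -/
def rho {n : ℕ} (ψ : Fin (2 ^ n) → ℂ) (j : Fin n) : Matrix (Fin 2) (Fin 2) ℂ :=
  Matrix.of fun a b =>
    ∑ f : Fin n → Fin 2,
      if f j = 0 then
        toQubits ψ (Function.update f j a) * (starRingEnd ℂ) (toQubits ψ (Function.update f j b))
      else 0

/-- Meyer–Wallach measure `Q(ψ) = 2(1 - (1/n) Σ_j Tr[ρ_j²])`. -/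
def Qmeasure {n : ℕ} (ψ : Fin (2 ^ n) → ℂ) : ℂ :=
  2 * (1 - (1 / (n : ℂ)) * ∑ j : Fin n, Matrix.trace (rho ψ j * rho ψ j))

/-- The Thue–Morse sequence, specified by its recursion (1-indexed). -/
def IsThueMorse (τ : ℕ → ℕ) : Prop :=
  τ 1 = 0 ∧ (∀ n, 1 ≤ n → τ (2 * n) = 1 - τ n) ∧ (∀ n, 1 ≤ n → τ (2 * n - 1) = τ n)

lemma matCast_apply {a b : ℕ} (h : a = b) (A : Matrix (Fin a) (Fin a) ℂ) (i j : Fin b) :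
    matCast h A i j = A (Fin.cast h.symm i) (Fin.cast h.symm j) := rfl

lemma matCast_matCast {a b c : ℕ} (h : a = b) (h' : b = c) (A : Matrix (Fin a) (Fin a) ℂ) :
    matCast h' (matCast h A) = matCast (h.trans h') A := rfl

lemma matCast_add {a b : ℕ} (h : a = b) (A B : Matrix (Fin a) (Fin a) ℂ) :
    matCast h (A + B) = matCast h A + matCast h B := rfl

lemma matCast_neg {a b : ℕ} (h : a = b) (A : Matrix (Fin a) (Fin a) ℂ) :
    matCast h (-A) = -matCast h A := rfl

lemma matCast_smul {a b : ℕ} (h : a = b) (c : ℂ) (A : Matrix (Fin a) (Fin a) ℂ) :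
    matCast h (c • A) = c • matCast h A := rfl

lemma matCast_mul {a b : ℕ} (h : a = b) (A B : Matrix (Fin a) (Fin a) ℂ) :
    matCast h (A * B) = matCast h A * matCast h B := by
  subst h; rfl

lemma conjTranspose_matCast {a b : ℕ} (h : a = b) (A : Matrix (Fin a) (Fin a) ℂ) :
    (matCast h A)ᴴ = matCast h Aᴴ := rfl

lemma kron_apply {a b : ℕ} (A : Matrix (Fin a) (Fin a) ℂ) (B : Matrix (Fin b) (Fin b) ℂ)
    (i j : Fin (a * b)) : kron A B i j = A i.divNat j.divNat * B i.modNat j.modNat := rfl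

lemma kron_mul_kron {a b : ℕ} (A C : Matrix (Fin a) (Fin a) ℂ) (B D : Matrix (Fin b) (Fin b) ℂ) :
    kron A B * kron C D = kron (A * C) (B * D) := by
  have h := Matrix.mul_kronecker_mul A C B D
  unfold kron
  rw [h]
  simp only [Matrix.reindex_apply, Matrix.submatrix_mul_equiv]

lemma conjTranspose_kron {a b : ℕ} (A : Matrix (Fin a) (Fin a) ℂ) (B : Matrix (Fin b) (Fin b) ℂ) :
    (kron A B)ᴴ = kron Aᴴ Bᴴ := by
  ext i j
  simp [kron_apply, Matrix.conjTranspose_apply]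

lemma kron_smul_left {a b : ℕ} (c : ℂ) (A : Matrix (Fin a) (Fin a) ℂ)
    (B : Matrix (Fin b) (Fin b) ℂ) : kron (c • A) B = c • kron A B := by
  ext i j
  simp [kron_apply, mul_assoc]

lemma kron_smul_right {a b : ℕ} (c : ℂ) (A : Matrix (Fin a) (Fin a) ℂ)
    (B : Matrix (Fin b) (Fin b) ℂ) : kron A (c • B) = c • kron A B := by
  ext i j
  simp [kron_apply, mul_left_comm]

lemma kron_add_left {a b : ℕ} (A A' : Matrix (Fin a) (Fin a) ℂ)
    (B : Matrix (Fin b) (Fin b) ℂ) : kron (A + A') B = kron A B + kron A' B := by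
  ext i j
  simp [kron_apply, add_mul]

lemma kron_zero_left {a b : ℕ} (B : Matrix (Fin b) (Fin b) ℂ) :
    kron (0 : Matrix (Fin a) (Fin a) ℂ) B = 0 := by
  ext i j
  simp [kron_apply]

lemma kron_matCast_left {a a' b : ℕ} (h : a = a') (A : Matrix (Fin a) (Fin a) ℂ)
    (B : Matrix (Fin b) (Fin b) ℂ) :
    kron (matCast h A) B = matCast (by rw [h]) (kron A B) := by
  subst h; rfl

lemma kron_matCast_right {a b b' : ℕ} (h : b = b') (A : Matrix (Fin a) (Fin a) ℂ)
    (B : Matrix (Fin b) (Fin b) ℂ) :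
    kron A (matCast h B) = matCast (by rw [h]) (kron A B) := by
  subst h; rfl

lemma kron_assoc {a b c : ℕ} (A : Matrix (Fin a) (Fin a) ℂ) (B : Matrix (Fin b) (Fin b) ℂ)
    (C : Matrix (Fin c) (Fin c) ℂ) :
    kron A (kron B C) = matCast (mul_assoc a b c) (kron (kron A B) C) := by
  have h₁ (k : Fin (a * (b * c))) :
      (Fin.cast (mul_assoc a b c).symm k).divNat.divNat = k.divNat := by
    ext; simp [Nat.div_div_eq_div_mul, mul_comm]
  have h₂ (k : Fin (a * (b * c))) :
      (Fin.cast (mul_assoc a b c).symm k).divNat.modNat = k.modNat.divNat := by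
    ext
    simp only [Fin.coe_modNat, Fin.coe_divNat, Fin.val_cast]
    exact (Nat.mod_mul_left_div_self _ _ _).symm
  have h₃ (k : Fin (a * (b * c))) :
      (Fin.cast (mul_assoc a b c).symm k).modNat = k.modNat.modNat := by
    ext; simp
  ext i j
  simp only [kron_apply, matCast_apply, h₁, h₂, h₃, mul_assoc]

lemma kpow_succ (A : Matrix (Fin 2) (Fin 2) ℂ) (k : ℕ) :
    kpow A (k + 1) = matCast (pow_succ' 2 k).symm (kron A (kpow A k)) := rfl

lemma kpow_succ' (A : Matrix (Fin 2) (Fin 2) ℂ) (k : ℕ) :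
    kpow A (k + 1) = matCast (pow_succ 2 k).symm (kron (kpow A k) A) := by
  induction k with
  | zero =>
    ext i j
    fin_cases i <;> fin_cases j <;>
      simp [kpow, matCast_apply, kron_apply, Matrix.one_apply, Fin.ext_iff] <;> rfl
  | succ k ih =>
    conv_lhs => rw [kpow_succ, ih]
    rw [kron_matCast_right, kron_assoc, matCast_matCast, matCast_matCast, kpow_succ A k,
      kron_matCast_left, matCast_matCast]

lemma kpow_mul (A B : Matrix (Fin 2) (Fin 2) ℂ) (k : ℕ) :
    kpow A k * kpow B k = kpow (A * B) k := by
  induction k with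
  | zero => exact one_mul _
  | succ k ih => rw [kpow_succ, kpow_succ, kpow_succ, ← matCast_mul, kron_mul_kron, ih]

lemma conjTranspose_kpow (A : Matrix (Fin 2) (Fin 2) ℂ) (k : ℕ) : (kpow A k)ᴴ = kpow Aᴴ k := by
  induction k with
  | zero => exact Matrix.conjTranspose_one
  | succ k ih => rw [kpow_succ, kpow_succ, conjTranspose_matCast, conjTranspose_kron, ih]

lemma σx_conjTranspose : σxᴴ = σx := by
  ext i j; fin_cases i <;> fin_cases j <;> simp [σx]

lemma projL_conjTranspose : projLᴴ = projL := by
  ext i j; fin_cases i <;> fin_cases j <;> simp [projL]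

lemma projR_conjTranspose : projRᴴ = projR := by
  ext i j; fin_cases i <;> fin_cases j <;> simp [projR]

lemma H2_conjTranspose : H2ᴴ = H2 := by
  ext i j; fin_cases i <;> fin_cases j <;> simp [H2]

lemma H2_mul_σx_mul_H2 : H2 * σx * H2 = σz := by
  have h : ((Real.sqrt 2 : ℝ) : ℂ)⁻¹ * ((Real.sqrt 2 : ℝ) : ℂ)⁻¹ = 1 / 2 := by
    rw [← mul_inv, ← Complex.ofReal_mul, Real.mul_self_sqrt (by norm_num)]
    norm_num
  ext i j
  fin_cases i <;> fin_cases j <;> simp [H2, σx, σz, h] <;> norm_num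

lemma σy_mul_σx : σy * σx = (-Complex.I) • σz := by
  ext i j; fin_cases i <;> fin_cases j <;> simp [σx, σy, σz]

lemma σx_mul_σy : σx * σy = Complex.I • σz := by
  ext i j; fin_cases i <;> fin_cases j <;> simp [σx, σy, σz]

lemma projL_mul_σy_mul_projL : projL * σy * projL = 0 := by
  ext i j; fin_cases i <;> fin_cases j <;> simp [projL, σy]

lemma projR_mul_σy_mul_projR : projR * σy * projR = 0 := by
  ext i j; fin_cases i <;> fin_cases j <;> simp [projR, σy]

lemma projL_projR_σy_combination :
    Complex.I • (projR * σy * projL) + (-Complex.I) • (projL * σy * projR) = (-1 : ℂ) • σx := by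
  ext i j; fin_cases i <;> fin_cases j <;> simp [projL, projR, σy, σx]

/-- Conjugating `M` by the generalized CNOT gate gives `-(σ_x^{⊗(n-1)} ⊗ σ_z)`. -/
lemma CNOT_conj_Mmat (m : ℕ) :
    (CNOT (m + 2))ᴴ * Mmat (m + 2) * CNOT (m + 2) =
      -matCast (pow_succ 2 (m + 1)).symm (kron (kpow σx (m + 1)) σz) := by
  set P : Matrix (Fin (2 ^ (m + 1))) (Fin (2 ^ (m + 1))) ℂ :=
    matCast (pow_succ 2 m).symm (kron 1 σy) with hP
  set Q : Matrix (Fin (2 ^ (m + 1))) (Fin (2 ^ (m + 1))) ℂ :=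
    matCast (pow_succ 2 m).symm (kron (kpow σx m) σz) with hQ
  set X := kpow σx (m + 1) with hX
  have e : 2 * 2 ^ (m + 1) = 2 ^ (m + 2) := (pow_succ' 2 (m + 1)).symm
  have hM : Mmat (m + 2) = matCast e (kron σy P) := by
    rw [hP, kron_matCast_right, matCast_matCast]; rfl
  have hC : CNOT (m + 2) = matCast e (kron projL 1 + kron projR X) := rfl
  have hXX : Xᴴ = X := by rw [hX, conjTranspose_kpow, σx_conjTranspose]
  have hPX : P * X = (-Complex.I) • Q := by
    rw [hP, hX, hQ, kpow_succ', ← matCast_mul, kron_mul_kron, one_mul, σy_mul_σx,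
      kron_smul_right, matCast_smul]
  have hXP : X * P = Complex.I • Q := by
    rw [hP, hX, hQ, kpow_succ', ← matCast_mul, kron_mul_kron, mul_one, σx_mul_σy,
      kron_smul_right, matCast_smul]
  have hR : matCast (pow_succ 2 (m + 1)).symm (kron X σz) = matCast e (kron σx Q) := by
    rw [hX, hQ, kpow_succ, kron_matCast_left, kron_matCast_right, kron_assoc,
      matCast_matCast, matCast_matCast, matCast_matCast]
  have key : (kron projL 1 + kron projR X) * kron σy P * (kron projL 1 + kron projR X) =
      -kron σx Q := by
    simp only [add_mul, mul_add, kron_mul_kron, projL_mul_σy_mul_projL, projR_mul_σy_mul_projR,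
      kron_zero_left, one_mul, mul_one, hPX, hXP, kron_smul_right, smul_mul_assoc]
    rw [zero_add, smul_zero, add_zero, ← kron_smul_left, ← kron_smul_left, ← kron_add_left,
      projL_projR_σy_combination, kron_smul_left, neg_one_smul]
  rw [hM, hC, hR, conjTranspose_matCast, Matrix.conjTranspose_add, conjTranspose_kron,
    conjTranspose_kron, hXX, projL_conjTranspose, projR_conjTranspose,
    Matrix.conjTranspose_one, ← matCast_mul, ← matCast_mul, key, matCast_neg]

lemma Lmat_eq_neg_kpow_σz (m : ℕ) : Lmat (m + 2) = -kpow σz (m + 2) := by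
  set G : Matrix (Fin (2 ^ (m + 2))) (Fin (2 ^ (m + 2))) ℂ :=
    matCast (pow_succ 2 (m + 1)).symm (kron (kpow H2 (m + 1)) 1) with hG
  have hB : Bmat (m + 2) = CNOT (m + 2) * G := rfl
  have hGG : Gᴴ = G := by
    rw [hG, conjTranspose_matCast, conjTranspose_kron, conjTranspose_kpow, H2_conjTranspose,
      Matrix.conjTranspose_one]
  have h : Lmat (m + 2) = G * ((CNOT (m + 2))ᴴ * Mmat (m + 2) * CNOT (m + 2)) * G := by
    rw [Lmat, hB, Matrix.conjTranspose_mul, hGG]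
    simp only [Matrix.mul_assoc]
  rw [h, CNOT_conj_Mmat, mul_neg, neg_mul, hG, ← matCast_mul, ← matCast_mul, kron_mul_kron,
    kron_mul_kron, kpow_mul, kpow_mul, H2_mul_σx_mul_H2, one_mul, mul_one, ← kpow_succ']

lemma IsThueMorse.le_one {τ : ℕ → ℕ} (hτ : IsThueMorse τ) (n : ℕ) (hn : 1 ≤ n) : τ n ≤ 1 := by
  induction n using Nat.strong_induction_on with
  | _ n ih =>
    obtain ⟨h₁, h₂, h₃⟩ := hτ
    rcases Nat.even_or_odd' n with ⟨q, rfl | rfl⟩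
    · rw [h₂ q (by omega)]; omega
    · rcases Nat.eq_zero_or_pos q with rfl | hq
      · simp [h₁]
      · have := h₃ (q + 1) (by omega)
        rw [show 2 * (q + 1) - 1 = 2 * q + 1 by omega] at this
        rw [this]
        exact ih (q + 1) (by omega) (by omega)

lemma kpow_σz_eq_diagonal {τ : ℕ → ℕ} (hτ : IsThueMorse τ) (k : ℕ) :
    kpow σz k = Matrix.diagonal fun i : Fin (2 ^ k) => 1 - 2 * (τ ((i : ℕ) + 1) : ℂ) := by
  induction k with
  | zero =>
    ext i j
    fin_cases i; fin_cases j
    simp [kpow, hτ.1]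
  | succ k ih =>
    have hσz : σz = Matrix.diagonal fun i : Fin 2 => 1 - 2 * ((i : ℕ) : ℂ) := by
      ext i j; fin_cases i <;> fin_cases j <;> norm_num [σz]
    ext i j
    rw [kpow_succ', matCast_apply, kron_apply, ih, hσz]
    by_cases hij : i = j
    · subst hij
      simp only [Matrix.diagonal_apply_eq, Fin.coe_divNat, Fin.coe_modNat, Fin.val_cast]
      have hle := hτ.le_one
      obtain ⟨-, h₂, h₃⟩ := hτ
      rcases Nat.even_or_odd' (i : ℕ) with ⟨q, hq | hq⟩
      · have h := h₃ (q + 1) (by omega)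
        rw [show 2 * (q + 1) - 1 = 2 * q + 1 by omega] at h
        rw [hq, h]
        simp
      · have h := h₂ (q + 1) (by omega)
        rw [hq, show 2 * q + 1 + 1 = 2 * (q + 1) by ring, h,
          Nat.cast_sub (hle (q + 1) (by omega)),
          show (2 * q + 1) / 2 = q by omega, show (2 * q + 1) % 2 = 1 by omega]
        push_cast
        ring
    · rw [Matrix.diagonal_apply_ne _ hij]
      by_cases hd : (Fin.cast (pow_succ 2 k) i).divNat = (Fin.cast (pow_succ 2 k) j).divNat
      · have hm : (Fin.cast (pow_succ 2 k) i).modNat ≠ (Fin.cast (pow_succ 2 k) j).modNat := by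
          intro hm
          apply hij
          have hd := congrArg Fin.val hd
          have hm := congrArg Fin.val hm
          simp only [Fin.coe_divNat, Fin.coe_modNat, Fin.val_cast] at hd hm
          ext
          omega
        rw [Matrix.diagonal_apply_ne _ hm, mul_zero]
      · rw [Matrix.diagonal_apply_ne _ hd, zero_mul]

/-- Lemma 7, second part: for all `n ≥ 2`, `L_{2^n}` is diagonal and its `i`-th
diagonal entry (1-indexed) equals `2τ_i - 1`, where `(τ_i)` is Thue–Morse. -/
theorem Lmat_diag_thueMorse (τ : ℕ → ℕ) (hτ : IsThueMorse τ) (n : ℕ) (hn : 2 ≤ n) :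
    (Lmat n).IsDiag ∧
    ∀ i : Fin (2 ^ n), Lmat n i i = 2 * (τ ((i : ℕ) + 1) : ℂ) - 1 := by
  obtain ⟨m, rfl⟩ := Nat.exists_eq_add_of_le' hn
  rw [Lmat_eq_neg_kpow_σz, kpow_σz_eq_diagonal hτ]
  refine ⟨(Matrix.isDiag_diagonal _).neg, fun i => ?_⟩
  rw [Matrix.neg_apply, Matrix.diagonal_apply_eq]
  ring

end
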